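/- arXiv:2511.07417 — 3 statements merged into one kernel-verified Lean document; each statement's English description precedes it below -/
import Mathlib

section
/- Fix c ∈ (0,1) and a countable collection of languages 𝓛 : ℕ → Set ℕ (each 𝓛 i infinite). The following are equivalent: (i) there exists an element-based generator G : List ℕ → ℕ such that for every index i and every enumeration x of K := 𝓛 i with c-noise and arbitrary omissions, there exists n* with G(x_1,…,x_n) ∈ K \ {x_1,…,x_n} for all n ≥ n*; (ii) for every nonempty finite subcollection 𝓛' of the languages {𝓛 i : i ∈ ℕ} and every injective sequence x : ℕ → ℕ, either there is some L' ∈ 𝓛' with R(L'; x_{1:n}) > c for infinitely many n, or the intersection ⋂_{L ∈ 𝓛'} L is infinite. -/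
open Filter Set Topology

/-- The list `[x 0, …, x (n-1)]` of the first `n` elements of the stream `x`
(the paper's `x_1, …, x_n`). -/
def prefixList (x : ℕ → ℕ) (n : ℕ) : List ℕ := (List.range n).map x

/-- The set of the first `n` elements of the stream `x` (the paper's `{x_1, …, x_n}`). -/
def seen (x : ℕ → ℕ) (n : ℕ) : Set ℕ := x '' {t | t < n}

/-- The empirical noise rate `R(L; x_{1:n})` of the first `n` elements of `x` w.r.t. `L`. -/
noncomputable def noiseRate (L : Set ℕ) (x : ℕ → ℕ) (n : ℕ) : ℝ :=
  (({t | t < n ∧ x t ∉ L}).ncard : ℝ) / n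

/-- `|A ∩ {b_1, …, b_m}| / m` where `b_1 < b_2 < …` is the increasing enumeration of `B`. -/
noncomputable def densityRatio (A B : Set ℕ) (m : ℕ) : ℝ :=
  (({j | j < m ∧ Nat.nth (· ∈ B) j ∈ A}).ncard : ℝ) / m

/-- Lower density `μ_low(A, B)` of `A` in `B`. -/
noncomputable def lowDensity (A B : Set ℕ) : ℝ := Filter.liminf (densityRatio A B) Filter.atTop

/-- Upper density `μ_up(A, B)` of `A` in `B`. -/
noncomputable def upDensity (A B : Set ℕ) : ℝ := Filter.limsup (densityRatio A B) Filter.atTop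

/-- The cons of `a` onto the stream `x`. -/
def consStream (a : ℕ) (x : ℕ → ℕ) : ℕ → ℕ
  | 0 => a
  | n + 1 => x n

lemma noise_finite (L : Set ℕ) (x : ℕ → ℕ) (n : ℕ) : {t | t < n ∧ x t ∉ L}.Finite :=
  (Set.finite_lt_nat n).subset fun _ h => h.1

lemma noiseRate_congr {L : Set ℕ} {x y : ℕ → ℕ} {n : ℕ} (h : ∀ t < n, x t = y t) :
    noiseRate L x n = noiseRate L y n := by
  have : {t | t < n ∧ x t ∉ L} = {t | t < n ∧ y t ∉ L} := by
    ext t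
    exact and_congr_right fun ht => by rw [h t ht]
  rw [noiseRate, noiseRate, this]

lemma consStream_injective {a : ℕ} {x : ℕ → ℕ} (hx : Function.Injective x)
    (ha : a ∉ Set.range x) : Function.Injective (consStream a x) := by
  rintro (_ | m) (_ | n) h
  · rfl
  · exact (ha ⟨n, h.symm⟩).elim
  · exact (ha ⟨m, h⟩).elim
  · exact congrArg _ (hx h)

lemma noiseRate_consStream_le {L : Set ℕ} {a : ℕ} (ha : a ∈ L) (x : ℕ → ℕ) (n : ℕ) :
    noiseRate L (consStream a x) n ≤ noiseRate L x n := by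
  have h : ({t | t < n ∧ consStream a x t ∉ L}).ncard ≤ ({t | t < n ∧ x t ∉ L}).ncard := by
    rw [← Set.ncard_image_of_injective {t | t < n ∧ x t ∉ L} Nat.succ_injective]
    refine Set.ncard_le_ncard ?_ ((noise_finite L x n).image _)
    rintro (_ | t) ⟨ht, hL⟩
    · exact (hL ha).elim
    · exact ⟨t, ⟨by omega, hL⟩, rfl⟩
  unfold noiseRate
  gcongr

/-- A stream can be made to enumerate any finite set `F` without raising its noise rate
with respect to any language containing `F`. -/
lemma exists_stream_covering {x : ℕ → ℕ} (hx : Function.Injective x) {F : Set ℕ}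
    (hF : F.Finite) :
    ∃ y : ℕ → ℕ, Function.Injective y ∧ F ⊆ Set.range y ∧
      ∀ L : Set ℕ, F ⊆ L → ∀ n, noiseRate L y n ≤ noiseRate L x n := by
  induction F, hF using Set.Finite.induction_on with
  | empty => exact ⟨x, hx, Set.empty_subset _, fun _ _ _ => le_rfl⟩
  | @insert a F _ _ ih =>
    obtain ⟨y, hy, hFy, hle⟩ := ih
    by_cases ha : a ∈ Set.range y
    · exact ⟨y, hy, Set.insert_subset ha hFy,
        fun L hL => hle L ((Set.subset_insert a F).trans hL)⟩
    · refine ⟨consStream a y, consStream_injective hy ha, Set.insert_subset ⟨0, rfl⟩ ?_, ?_⟩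
      · intro b hb
        obtain ⟨n, rfl⟩ := hFy hb
        exact ⟨n + 1, rfl⟩
      · intro L hL n
        exact (noiseRate_consStream_le (hL (Set.mem_insert a F)) y n).trans
          (hle L ((Set.subset_insert a F).trans hL) n)

lemma infinite_hits_of_noiseRate_le {c : ℝ} (hc : c < 1) {L : Set ℕ} {x : ℕ → ℕ} {m : ℕ}
    (h : ∀ n ≥ m, noiseRate L x n ≤ c) : {n | x n ∈ L}.Infinite := by
  intro hfin
  obtain ⟨B, hB⟩ := hfin.bddAbove
  obtain ⟨k, hk⟩ := exists_nat_gt (((B : ℝ) + 1) / (1 - c))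
  set n := max (max m k) (B + 1)
  have hkn : (k : ℝ) ≤ n := by exact_mod_cast (le_max_right m k).trans (le_max_left _ _)
  have hmn : m ≤ n := (le_max_left m k).trans (le_max_left _ _)
  have hn0 : (0 : ℝ) < n := by
    exact_mod_cast (Nat.succ_pos B).trans_le (le_max_right (max m k) (B + 1))
  have hcount : n - (B + 1) ≤ ({t | t < n ∧ x t ∉ L}).ncard := by
    rw [← Nat.card_Ico (B + 1) n, ← Set.ncard_coe_finset]
    refine Set.ncard_le_ncard ?_ (noise_finite L x n)
    intro t ht
    rw [Finset.coe_Ico, Set.mem_Ico] at ht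
    refine ⟨ht.2, fun hL => ?_⟩
    have := hB hL
    omega
  have hcount' : (n : ℝ) ≤ ({t | t < n ∧ x t ∉ L}).ncard + (B + 1) := by
    exact_mod_cast Nat.sub_le_iff_le_add.mp hcount
  have hrate := h n hmn
  rw [noiseRate, div_le_iff₀ hn0] at hrate
  rw [div_lt_iff₀ (by linarith)] at hk
  nlinarith

/-- The indices at most `t` whose languages show noise rate at most `c` on every prefix of `x`
of length in `(t, n]`. -/
noncomputable def plausible (c : ℝ) (𝓛 : ℕ → Set ℕ) (x : ℕ → ℕ) (n t : ℕ) : Finset ℕ :=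
  open Classical in
  (Finset.range (t + 1)).filter fun j => ∀ m, t < m → m ≤ n → noiseRate (𝓛 j) x m ≤ c

lemma mem_plausible {c : ℝ} {𝓛 : ℕ → Set ℕ} {x : ℕ → ℕ} {n t j : ℕ} :
    j ∈ plausible c 𝓛 x n t ↔
      j ≤ t ∧ ∀ m, t < m → m ≤ n → noiseRate (𝓛 j) x m ≤ c := by
  simp [plausible]

lemma plausible_congr {c : ℝ} {𝓛 : ℕ → Set ℕ} {x y : ℕ → ℕ} {n : ℕ}
    (h : ∀ t < n, x t = y t) : plausible c 𝓛 x n = plausible c 𝓛 y n := by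
  ext t j
  simp only [mem_plausible]
  refine and_congr_right fun _ => forall_congr' fun m => forall_congr' fun _ =>
    forall_congr' fun hm => ?_
  rw [noiseRate_congr fun k hk => h k (hk.trans_le hm)]

lemma eventually_noiseRate_le_of_mem_plausible {c : ℝ} {𝓛 : ℕ → Set ℕ} {x : ℕ → ℕ} (t : ℕ) :
    ∃ N, ∀ n ≥ N, ∀ j ∈ plausible c 𝓛 x n t, ∀ m, t < m → noiseRate (𝓛 j) x m ≤ c := by
  have hj : ∀ j, ∀ᶠ n in atTop, j ∈ plausible c 𝓛 x n t →
      ∀ m, t < m → noiseRate (𝓛 j) x m ≤ c := by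
    intro j
    by_cases hgood : ∀ m, t < m → noiseRate (𝓛 j) x m ≤ c
    · exact Eventually.of_forall fun _ _ => hgood
    · push Not at hgood
      obtain ⟨m, htm, hm⟩ := hgood
      filter_upwards [eventually_ge_atTop m] with n hn hmem
      exact absurd ((mem_plausible.mp hmem).2 m htm hn) hm.not_ge
  obtain ⟨N, hN⟩ := eventually_atTop.mp
    ((Finset.eventually_all (Finset.range (t + 1))).mpr fun j _ => hj j)
  exact ⟨N, fun n hn j hmem => hN n hn j
    (Finset.mem_range_succ_iff.mpr (mem_plausible.mp hmem).1) hmem⟩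

/-- The largest threshold up to `n` for which the plausible languages have infinite
intersection. -/
noncomputable def bestThreshold (c : ℝ) (𝓛 : ℕ → Set ℕ) (x : ℕ → ℕ) (n : ℕ) : ℕ :=
  open Classical in
  Nat.findGreatest (fun t => (⋂ j ∈ plausible c 𝓛 x n t, 𝓛 j).Infinite) n

lemma infinite_iInter_plausible_bestThreshold {c : ℝ} {𝓛 : ℕ → Set ℕ} {x : ℕ → ℕ} {n t : ℕ}
    (htn : t ≤ n) (h : (⋂ j ∈ plausible c 𝓛 x n t, 𝓛 j).Infinite) :
    (⋂ j ∈ plausible c 𝓛 x n (bestThreshold c 𝓛 x n), 𝓛 j).Infinite := by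
  classical
  exact Nat.findGreatest_spec
    (P := fun t => (⋂ j ∈ plausible c 𝓛 x n t, 𝓛 j).Infinite) htn h

lemma le_bestThreshold {c : ℝ} {𝓛 : ℕ → Set ℕ} {x : ℕ → ℕ} {n t : ℕ}
    (htn : t ≤ n) (h : (⋂ j ∈ plausible c 𝓛 x n t, 𝓛 j).Infinite) :
    t ≤ bestThreshold c 𝓛 x n := by
  classical
  exact Nat.le_findGreatest
    (P := fun t => (⋂ j ∈ plausible c 𝓛 x n t, 𝓛 j).Infinite) htn h

lemma bestThreshold_congr {c : ℝ} {𝓛 : ℕ → Set ℕ} {x y : ℕ → ℕ} {n : ℕ}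
    (h : ∀ t < n, x t = y t) : bestThreshold c 𝓛 x n = bestThreshold c 𝓛 y n := by
  rw [bestThreshold, plausible_congr h, ← bestThreshold]

/-- Outputs an unseen element of the common part of the languages that are plausible at the
best threshold. -/
noncomputable def plausibleGenerator (c : ℝ) (𝓛 : ℕ → Set ℕ) (l : List ℕ) : ℕ :=
  let x := fun k => l.getD k 0
  Classical.epsilon fun a =>
    a ∈ (⋂ j ∈ plausible c 𝓛 x l.length (bestThreshold c 𝓛 x l.length), 𝓛 j) ∧ a ∉ l

lemma mem_prefixList {x : ℕ → ℕ} {n a : ℕ} : a ∈ prefixList x n ↔ a ∈ seen x n := by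
  simp [prefixList, seen]

lemma plausibleGenerator_spec {c : ℝ} {𝓛 : ℕ → Set ℕ} {x : ℕ → ℕ} {n t i : ℕ} (htn : t ≤ n)
    (hinter : (⋂ j ∈ plausible c 𝓛 x n t, 𝓛 j).Infinite) (hit : i ≤ t)
    (hi : ∀ m, t < m → noiseRate (𝓛 i) x m ≤ c) :
    plausibleGenerator c 𝓛 (prefixList x n) ∈ 𝓛 i \ seen x n := by
  have hlen : (prefixList x n).length = n := by simp [prefixList]
  have hget : ∀ k < n, (prefixList x n).getD k 0 = x k := by
    intro k hk
    simp [prefixList, hk]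
  have hpl := plausible_congr (c := c) (𝓛 := 𝓛) hget
  set b := bestThreshold c 𝓛 x n with hb
  have hbest : (⋂ j ∈ plausible c 𝓛 x n b, 𝓛 j).Infinite :=
    infinite_iInter_plausible_bestThreshold htn hinter
  have htb : t ≤ b := le_bestThreshold htn hinter
  have hib : i ∈ plausible c 𝓛 x n b :=
    mem_plausible.mpr ⟨hit.trans htb, fun m hm _ => hi m (htb.trans_lt hm)⟩
  obtain ⟨a, ha, hal⟩ := hbest.exists_notMem_finset (prefixList x n).toFinset
  have hspec := Classical.epsilon_spec
    (p := fun a => a ∈ (⋂ j ∈ plausible c 𝓛 x n b, 𝓛 j) ∧ a ∉ prefixList x n)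
    ⟨a, ha, fun h => hal (List.mem_toFinset.mpr h)⟩
  have hG : plausibleGenerator c 𝓛 (prefixList x n) = Classical.epsilon
      fun a => a ∈ (⋂ j ∈ plausible c 𝓛 x n b, 𝓛 j) ∧ a ∉ prefixList x n := by
    simp only [plausibleGenerator, hlen, hpl, bestThreshold_congr hget, hb]
  rw [hG]
  exact ⟨Set.mem_iInter₂.mp hspec.1 i hib, fun h => hspec.2 (mem_prefixList.mpr h)⟩

lemma eventually_le_of_not_infinite_gt {c : ℝ} (u : ℕ → ℝ) (h : ¬ {n | u n > c}.Infinite) :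
    ∃ m, ∀ n ≥ m, u n ≤ c := by
  obtain ⟨B, hB⟩ := (Set.not_infinite.mp h).bddAbove
  refine ⟨B + 1, fun n hn => not_lt.mp fun hlt => ?_⟩
  have := hB hlt
  omega

/-- Characterization of generation in the limit under `c`-noise and arbitrary omissions. -/
theorem constant_noise_generation_characterization (c : ℝ) (hc : c ∈ Set.Ioo (0:ℝ) 1)
    (𝓛 : ℕ → Set ℕ) (hinf : ∀ i, (𝓛 i).Infinite) :
    (∃ G : List ℕ → ℕ, ∀ i : ℕ, ∀ x : ℕ → ℕ,
      Function.Injective x →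
      {n : ℕ | x n ∈ 𝓛 i}.Infinite →
      (∃ m : ℕ, ∀ n ≥ m, noiseRate (𝓛 i) x n ≤ c) →
      ∃ nstar : ℕ, ∀ n ≥ nstar, G (prefixList x n) ∈ 𝓛 i \ seen x n)
    ↔
    (∀ s : Finset ℕ, s.Nonempty → ∀ x : ℕ → ℕ, Function.Injective x →
      (∃ i ∈ s, {n : ℕ | noiseRate (𝓛 i) x n > c}.Infinite) ∨ (⋂ i ∈ s, 𝓛 i).Infinite) := by
  constructor
  · rintro ⟨G, hG⟩ s hs x hx
    by_contra! hcon
    obtain ⟨hrate, hfin⟩ := hcon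
    obtain ⟨y, hy, hcover, hle⟩ := exists_stream_covering hx hfin
    have hgen : ∀ i ∈ s, ∀ᶠ n in atTop, G (prefixList y n) ∈ 𝓛 i \ seen y n := by
      intro i hi
      obtain ⟨m, hm⟩ :=
        eventually_le_of_not_infinite_gt _ (Set.not_infinite.mpr (hrate i hi))
      have hm' : ∀ n ≥ m, noiseRate (𝓛 i) y n ≤ c := fun n hn =>
        (hle _ (Set.biInter_subset_of_mem hi) n).trans (hm n hn)
      exact eventually_atTop.mpr
        (hG i y hy (infinite_hits_of_noiseRate_le hc.2 hm') ⟨m, hm'⟩)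
    have hseen : ∀ᶠ n in atTop, (⋂ i ∈ s, 𝓛 i) ⊆ seen y n := by
      refine (Set.Finite.eventually_all hfin).mpr fun a ha => ?_
      obtain ⟨k, rfl⟩ := hcover ha
      filter_upwards [eventually_gt_atTop k] with n hn
      exact ⟨k, hn, rfl⟩
    obtain ⟨n, hn, hsub⟩ := (((Finset.eventually_all s).mpr hgen).and hseen).exists
    obtain ⟨i, hi⟩ := hs
    exact (hn i hi).2 (hsub (Set.mem_iInter₂.mpr fun j hj => (hn j hj).1))
  · intro h
    refine ⟨plausibleGenerator c 𝓛, fun i x hx _ ⟨m, hm⟩ => ?_⟩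
    set t := max i m
    have hi : ∀ k, t < k → noiseRate (𝓛 i) x k ≤ c := fun k hk =>
      hm k ((le_max_right i m).trans hk.le)
    obtain ⟨N, hN⟩ := eventually_noiseRate_le_of_mem_plausible (c := c) (𝓛 := 𝓛) (x := x) t
    refine ⟨max N t, fun n hn => ?_⟩
    have hinter : (⋂ j ∈ plausible c 𝓛 x n t, 𝓛 j).Infinite := by
      refine (h (plausible c 𝓛 x n t)
        ⟨i, mem_plausible.mpr ⟨le_max_left i m, fun k hk _ => hi k hk⟩⟩ x hx).resolve_left ?_
      rintro ⟨j, hj, hbad⟩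
      refine hbad ((Set.finite_le_nat t).subset fun k hk => ?_)
      by_contra htk
      replace htk : t < k := not_le.mp htk
      exact (hN n ((le_max_left N t).trans hn) j hj k htk).not_gt hk
    exact plausibleGenerator_spec ((le_max_right N t).trans hn) hinter (le_max_left i m) hi
end

section
/- Fix c ∈ (0,1], ρ ∈ (0,1], and a countable collection of languages 𝓛 : ℕ → Set ℕ (each 𝓛 i infinite). The following are equivalent: (i) there exists a set-based generator G : List ℕ → Set ℕ such that for every index i and every enumeration x of K := 𝓛 i with c-noise and arbitrary omissions, G generates in the limit from K under x and liminf_{n→∞} μ_low(G(x_1,…,x_n), K) ≥ ρ; (ii) for every nonempty finite subcollection 𝓛' of {𝓛 i : i ∈ ℕ} and every injective sequence x : ℕ → ℕ, either there exists L' ∈ 𝓛' with R(L'; x_{1:n}) > c for infinitely many n, or every L ∈ 𝓛' satisfies μ_low(⋂_{L' ∈ 𝓛'} L', L) ≥ ρ. -/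
open Filter Set Topology

lemma densityRatio_nonneg (A B : Set ℕ) (m : ℕ) : 0 ≤ densityRatio A B m := by
  unfold densityRatio
  positivity

lemma finite_setOf_lt_and (p : ℕ → Prop) (n : ℕ) : {t | t < n ∧ p t}.Finite :=
  (Set.finite_Iio n).subset fun _ h => h.1

lemma ncard_setOf_lt_and_le (p : ℕ → Prop) (n : ℕ) : {t | t < n ∧ p t}.ncard ≤ n := by
  calc {t | t < n ∧ p t}.ncard ≤ (Set.Iio n).ncard :=
        Set.ncard_le_ncard (fun _ h => h.1) (Set.finite_Iio n)
    _ = n := by simp [Set.ncard_eq_toFinset_card']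

lemma densityRatio_le_one (A B : Set ℕ) (m : ℕ) : densityRatio A B m ≤ 1 :=
  div_le_one_of_le₀ (by exact_mod_cast ncard_setOf_lt_and_le _ m) (Nat.cast_nonneg m)

lemma noiseRate_le_one (L : Set ℕ) (x : ℕ → ℕ) (n : ℕ) : noiseRate L x n ≤ 1 :=
  div_le_one_of_le₀ (by exact_mod_cast ncard_setOf_lt_and_le _ n) (Nat.cast_nonneg n)

lemma isBoundedUnder_ge_densityRatio (A B : Set ℕ) :
    IsBoundedUnder (· ≥ ·) atTop (densityRatio A B) :=
  isBoundedUnder_of ⟨0, densityRatio_nonneg A B⟩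

lemma isCoboundedUnder_ge_densityRatio (A B : Set ℕ) :
    IsCoboundedUnder (· ≥ ·) atTop (densityRatio A B) :=
  (isBoundedUnder_of ⟨1, densityRatio_le_one A B⟩ :
    IsBoundedUnder (· ≤ ·) atTop (densityRatio A B)).isCoboundedUnder_ge

lemma lowDensity_nonneg (A B : Set ℕ) : 0 ≤ lowDensity A B :=
  le_liminf_of_le (isCoboundedUnder_ge_densityRatio A B)
    (Eventually.of_forall (densityRatio_nonneg A B))

lemma lowDensity_le_one (A B : Set ℕ) : lowDensity A B ≤ 1 :=
  liminf_le_of_frequently_le (Frequently.of_forall (densityRatio_le_one A B))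
    (isBoundedUnder_ge_densityRatio A B)

lemma densityRatio_mono {A A' : Set ℕ} (h : A ⊆ A') (B : Set ℕ) (m : ℕ) :
    densityRatio A B m ≤ densityRatio A' B m := by
  unfold densityRatio
  gcongr
  exact finite_setOf_lt_and _ _

lemma lowDensity_mono {A A' : Set ℕ} (h : A ⊆ A') (B : Set ℕ) :
    lowDensity A B ≤ lowDensity A' B :=
  liminf_le_liminf (Eventually.of_forall (densityRatio_mono h B))
    (isBoundedUnder_ge_densityRatio A B) (isCoboundedUnder_ge_densityRatio A' B)

lemma densityRatio_le_diff_add {B F : Set ℕ} (A : Set ℕ) (hB : B.Infinite) (hF : F.Finite)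
    (m : ℕ) : densityRatio A B m ≤ densityRatio (A \ F) B m + (F.ncard : ℝ) / m := by
  unfold densityRatio
  rw [← add_div]
  gcongr
  have hinj : Function.Injective (Nat.nth (· ∈ B)) := Nat.nth_injective hB
  have hpre : (Nat.nth (· ∈ B) ⁻¹' F).Finite := hF.preimage hinj.injOn
  have hcard : (Nat.nth (· ∈ B) ⁻¹' F).ncard ≤ F.ncard :=
    Set.ncard_le_ncard_of_injOn _ (fun _ h => h) hinj.injOn hF
  have hsub : {j | j < m ∧ Nat.nth (· ∈ B) j ∈ A} ⊆
      {j | j < m ∧ Nat.nth (· ∈ B) j ∈ A \ F} ∪ Nat.nth (· ∈ B) ⁻¹' F := by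
    intro j hj
    by_cases hjF : Nat.nth (· ∈ B) j ∈ F
    · exact Or.inr hjF
    · exact Or.inl ⟨hj.1, hj.2, hjF⟩
  have := (Set.ncard_le_ncard hsub ((finite_setOf_lt_and _ _).union hpre)).trans
    (Set.ncard_union_le _ _)
  exact_mod_cast this.trans (by gcongr)

/-- Removing finitely many elements does not decrease the lower density. -/
lemma lowDensity_le_lowDensity_diff {B F : Set ℕ} (A : Set ℕ) (hB : B.Infinite)
    (hF : F.Finite) : lowDensity A B ≤ lowDensity (A \ F) B := by
  refine le_of_forall_lt fun a ha => ?_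
  obtain ⟨b, hab, hb⟩ := exists_between ha
  obtain ⟨d, hbd, hd⟩ := exists_between hb
  have h₁ := eventually_lt_of_lt_liminf hd (isBoundedUnder_ge_densityRatio A B)
  have h₂ : ∀ᶠ m : ℕ in atTop, (F.ncard : ℝ) / m < d - b :=
    (tendsto_const_div_atTop_nhds_zero_nat _).eventually_lt_const (sub_pos.2 hbd)
  refine hab.trans_le (le_liminf_of_le (isCoboundedUnder_ge_densityRatio _ _) ?_)
  filter_upwards [h₁, h₂] with m hm₁ hm₂
  linarith [densityRatio_le_diff_add A hB hF m]

/-- A stream whose noise rate is eventually at most `c < 1` meets the language infinitely often. -/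
lemma infinite_of_noiseRate_le {L : Set ℕ} {x : ℕ → ℕ} {c : ℝ} (hc : c < 1) {m : ℕ}
    (h : ∀ n ≥ m, noiseRate L x n ≤ c) : {n | x n ∈ L}.Infinite := by
  intro hfin
  obtain ⟨k, hk⟩ := exists_nat_gt (({n | x n ∈ L}.ncard : ℝ) / (1 - c))
  set n := max (max m k) 1
  have hn : (0 : ℝ) < n := by
    exact_mod_cast lt_of_lt_of_le one_pos (le_max_right (max m k) 1)
  have hkn : (k : ℝ) ≤ n := by
    exact_mod_cast (le_max_right m k).trans (le_max_left _ 1)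
  have hrate := h n ((le_max_left m k).trans (le_max_left _ 1))
  rw [noiseRate, div_le_iff₀ hn] at hrate
  rw [div_lt_iff₀ (sub_pos.2 hc)] at hk
  have hsub : Set.Iio n ⊆ {t | t < n ∧ x t ∉ L} ∪ {t | x t ∈ L} := by
    intro t ht
    by_cases hL : x t ∈ L
    · exact Or.inr hL
    · exact Or.inl ⟨ht, hL⟩
  have hcard := (Set.ncard_le_ncard hsub ((finite_setOf_lt_and _ _).union hfin)).trans
    (Set.ncard_union_le _ _)
  rw [show (Set.Iio n).ncard = n by simp [Set.ncard_eq_toFinset_card']] at hcard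
  have hcard' : (n : ℝ) ≤ {t | t < n ∧ x t ∉ L}.ncard + {t | x t ∈ L}.ncard := by
    exact_mod_cast hcard
  nlinarith

/-- The list `l` as a stream padded by zeros. -/
def streamOfList (l : List ℕ) (t : ℕ) : ℕ := l.getD t 0

lemma streamOfList_prefixList (x : ℕ → ℕ) {n t : ℕ} (h : t < n) :
    streamOfList (prefixList x n) t = x t := by
  simp [streamOfList, prefixList, h]

lemma noiseRate_streamOfList_prefixList (L : Set ℕ) (x : ℕ → ℕ) {n m : ℕ} (h : m ≤ n) :
    noiseRate L (streamOfList (prefixList x n)) m = noiseRate L x m := by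
  unfold noiseRate
  congr 3
  ext t
  simp only [Set.mem_ofPred_eq]
  refine and_congr_right fun ht => ?_
  rw [streamOfList_prefixList x (ht.trans_le h)]

lemma setOf_mem_prefixList (x : ℕ → ℕ) (n : ℕ) : {a | a ∈ prefixList x n} = seen x n := by
  ext a
  simp [prefixList, seen]

open Classical in
/-- The indices `j ≤ p` whose language has noise rate at most `c` on every prefix of `l` of length
greater than `p`. -/
noncomputable def consistentIndices (𝓛 : ℕ → Set ℕ) (c : ℝ) (l : List ℕ) (p : ℕ) : Finset ℕ :=
  (Finset.range (p + 1)).filter fun j =>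
    ∀ m, p < m → m ≤ l.length → noiseRate (𝓛 j) (streamOfList l) m ≤ c

open Classical in
/-- The indices `j ≤ p` whose language has noise rate at most `c` on every prefix of `x` of length
greater than `p`. -/
noncomputable def limitIndices (𝓛 : ℕ → Set ℕ) (c : ℝ) (x : ℕ → ℕ) (p : ℕ) : Finset ℕ :=
  (Finset.range (p + 1)).filter fun j => ∀ m, p < m → noiseRate (𝓛 j) x m ≤ c

lemma mem_consistentIndices_prefixList {𝓛 : ℕ → Set ℕ} {c : ℝ} {x : ℕ → ℕ} {n p j : ℕ} :
    j ∈ consistentIndices 𝓛 c (prefixList x n) p ↔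
      j ≤ p ∧ ∀ m, p < m → m ≤ n → noiseRate (𝓛 j) x m ≤ c := by
  have hlen : (prefixList x n).length = n := by simp [prefixList]
  simp only [consistentIndices, Finset.mem_filter, Finset.mem_range, Nat.lt_succ_iff, hlen]
  refine and_congr_right fun _ => forall_congr' fun m => imp_congr_right fun _ =>
    forall_congr' fun hm => ?_
  rw [noiseRate_streamOfList_prefixList _ _ hm]

lemma mem_limitIndices {𝓛 : ℕ → Set ℕ} {c : ℝ} {x : ℕ → ℕ} {p j : ℕ} :
    j ∈ limitIndices 𝓛 c x p ↔ j ≤ p ∧ ∀ m, p < m → noiseRate (𝓛 j) x m ≤ c := by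
  simp [limitIndices]

lemma eventually_consistentIndices_eq (𝓛 : ℕ → Set ℕ) (c : ℝ) (x : ℕ → ℕ) (p : ℕ) :
    ∀ᶠ n in atTop, consistentIndices 𝓛 c (prefixList x n) p = limitIndices 𝓛 c x p := by
  have key : ∀ j, ∀ᶠ n in atTop, j ∈ consistentIndices 𝓛 c (prefixList x n) p →
      j ∈ limitIndices 𝓛 c x p := by
    intro j
    by_cases h : ∀ m, p < m → noiseRate (𝓛 j) x m ≤ c
    · exact Eventually.of_forall fun n hj =>
        mem_limitIndices.2 ⟨(mem_consistentIndices_prefixList.1 hj).1, h⟩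
    · push Not at h
      obtain ⟨m, hpm, hm⟩ := h
      filter_upwards [eventually_ge_atTop m] with n hn hj
      exact absurd ((mem_consistentIndices_prefixList.1 hj).2 m hpm hn) (not_le.2 hm)
  have hall : ∀ᶠ n in atTop, ∀ j ∈ Finset.range (p + 1),
      j ∈ consistentIndices 𝓛 c (prefixList x n) p → j ∈ limitIndices 𝓛 c x p :=
    (Filter.eventually_all_finset _).2 fun j _ => key j
  filter_upwards [hall] with n hn
  ext j
  refine ⟨fun hj => hn j (Finset.mem_range.2 (Nat.lt_succ_of_le
    (mem_consistentIndices_prefixList.1 hj).1)) hj, fun hj => ?_⟩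
  obtain ⟨hjp, h⟩ := mem_limitIndices.1 hj
  exact mem_consistentIndices_prefixList.2 ⟨hjp, fun m hm _ => h m hm⟩

/-- The intersection of the languages indexed by `s` has lower density at least `ρ` in each
of them. -/
def DenseInter (𝓛 : ℕ → Set ℕ) (ρ : ℝ) (s : Finset ℕ) : Prop :=
  ∀ i ∈ s, lowDensity (⋂ j ∈ s, 𝓛 j) (𝓛 i) ≥ ρ

open Classical in
/-- The largest threshold, at most the length of `l`, whose consistent languages have
a dense intersection. -/
noncomputable def threshold (𝓛 : ℕ → Set ℕ) (c ρ : ℝ) (l : List ℕ) : ℕ :=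
  Nat.findGreatest (fun p => DenseInter 𝓛 ρ (consistentIndices 𝓛 c l p)) l.length

/-- The generator intersecting the consistent languages of the largest admissible threshold. -/
noncomputable def intersectionGenerator (𝓛 : ℕ → Set ℕ) (c ρ : ℝ) (l : List ℕ) : Set ℕ :=
  (⋂ j ∈ consistentIndices 𝓛 c l (threshold 𝓛 c ρ l), 𝓛 j) \ {a | a ∈ l}

/-- If every finite family of languages of noise rate eventually at most `c` has a dense
intersection, the generator is eventually correct and dense. -/
lemma eventually_intersectionGenerator {𝓛 : ℕ → Set ℕ} {c ρ : ℝ} {x : ℕ → ℕ}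
    (hinf : ∀ i, (𝓛 i).Infinite)
    (hdense : ∀ s : Finset ℕ, s.Nonempty →
      (∀ j ∈ s, ∃ m, ∀ n ≥ m, noiseRate (𝓛 j) x n ≤ c) → DenseInter 𝓛 ρ s)
    {i : ℕ} (hi : ∃ m, ∀ n ≥ m, noiseRate (𝓛 i) x n ≤ c) :
    ∀ᶠ n in atTop, intersectionGenerator 𝓛 c ρ (prefixList x n) ⊆ 𝓛 i \ seen x n ∧
      ρ ≤ lowDensity (intersectionGenerator 𝓛 c ρ (prefixList x n)) (𝓛 i) := by
  classical
  obtain ⟨m₀, hm₀⟩ := hi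
  set p := max i m₀
  have hip : ∀ q ≥ p, ∀ n, i ∈ consistentIndices 𝓛 c (prefixList x n) q := fun q hq n =>
    mem_consistentIndices_prefixList.2 ⟨(le_max_left _ _).trans hq, fun m hm _ =>
      hm₀ m (((le_max_right _ _).trans hq).trans hm.le)⟩
  have hlim : i ∈ limitIndices 𝓛 c x p := mem_limitIndices.2 ⟨le_max_left _ _, fun m hm =>
      hm₀ m ((le_max_right _ _).trans hm.le)⟩
  have hP : DenseInter 𝓛 ρ (limitIndices 𝓛 c x p) :=
    hdense _ ⟨i, hlim⟩ fun j hj => ⟨p + 1, fun n hn => (mem_limitIndices.1 hj).2 n hn⟩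
  filter_upwards [eventually_consistentIndices_eq 𝓛 c x p, eventually_ge_atTop p] with n hn hpn
  have hlen : p ≤ (prefixList x n).length := by simpa [prefixList] using hpn
  rw [← hn] at hP
  have hge : p ≤ threshold 𝓛 c ρ (prefixList x n) := Nat.le_findGreatest hlen hP
  have hspec : DenseInter 𝓛 ρ
      (consistentIndices 𝓛 c (prefixList x n) (threshold 𝓛 c ρ (prefixList x n))) :=
    Nat.findGreatest_spec (P := fun p => DenseInter 𝓛 ρ
      (consistentIndices 𝓛 c (prefixList x n) p)) hlen hP
  have hmem := hip _ hge n
  rw [intersectionGenerator, setOf_mem_prefixList]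
  refine ⟨Set.sdiff_subset_sdiff_left (Set.biInter_subset_of_mem hmem), ?_⟩
  exact (hspec i hmem).trans
    (lowDensity_le_lowDensity_diff _ (hinf i) ((Set.finite_Iio n).image x))

/-- A stream on which all languages of a finite family are generated densely forces their
intersection to be dense. -/
lemma denseInter_of_generates {𝓛 : ℕ → Set ℕ} {ρ : ℝ} {s : Finset ℕ} {g S : ℕ → Set ℕ}
    (h : ∀ i ∈ s, (∃ nstar : ℕ, ∀ n ≥ nstar, g n ⊆ 𝓛 i \ S n) ∧
      Filter.liminf (fun n => lowDensity (g n) (𝓛 i)) Filter.atTop ≥ ρ) :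
    DenseInter 𝓛 ρ s := by
  intro i hi
  have hsub : ∀ᶠ n in atTop, ∀ j ∈ s, g n ⊆ 𝓛 j :=
    (Filter.eventually_all_finset _).2 fun j hj => by
      obtain ⟨N, hN⟩ := (h j hj).1
      filter_upwards [eventually_ge_atTop N] with n hn
      exact (hN n hn).trans Set.sdiff_subset
  refine (h i hi).2.le.trans (liminf_le_of_frequently_le (Eventually.frequently ?_)
    (isBoundedUnder_of ⟨0, fun n => lowDensity_nonneg _ _⟩))
  filter_upwards [hsub] with n hn
  exact lowDensity_mono (Set.subset_iInter₂ hn) _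

/-- Characterization of set-based lower density `ρ` generation under `c`-noise and
arbitrary omissions. -/
theorem set_based_density_constant_noise_characterization
    (c : ℝ) (hc : c ∈ Set.Ioc (0:ℝ) 1) (ρ : ℝ) (hρ : ρ ∈ Set.Ioc (0:ℝ) 1)
    (𝓛 : ℕ → Set ℕ) (hinf : ∀ i, (𝓛 i).Infinite) :
    (∃ G : List ℕ → Set ℕ, ∀ i : ℕ, ∀ x : ℕ → ℕ,
      Function.Injective x →
      {n : ℕ | x n ∈ 𝓛 i}.Infinite →
      (∃ m : ℕ, ∀ n ≥ m, noiseRate (𝓛 i) x n ≤ c) →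
      (∃ nstar : ℕ, ∀ n ≥ nstar, G (prefixList x n) ⊆ 𝓛 i \ seen x n) ∧
      Filter.liminf (fun n => lowDensity (G (prefixList x n)) (𝓛 i)) Filter.atTop ≥ ρ)
    ↔
    (∀ s : Finset ℕ, s.Nonempty → ∀ x : ℕ → ℕ, Function.Injective x →
      (∃ i ∈ s, {n : ℕ | noiseRate (𝓛 i) x n > c}.Infinite) ∨
      (∀ i ∈ s, lowDensity (⋂ j ∈ s, 𝓛 j) (𝓛 i) ≥ ρ)) := by
  constructor
  · rintro ⟨G, hG⟩ s - x hx
    by_cases hs : ∃ i ∈ s, {n : ℕ | noiseRate (𝓛 i) x n > c}.Infinite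
    · exact Or.inl hs
    right
    push Not at hs
    have hgood : ∀ i ∈ s, ∃ m : ℕ, ∀ n ≥ m, noiseRate (𝓛 i) x n ≤ c := fun i hi => by
      have hev : ∀ᶠ n in atTop, ¬ noiseRate (𝓛 i) x n > c := by
        rw [← Nat.cofinite_eq_atTop]
        exact (hs i hi).eventually_cofinite_notMem
      obtain ⟨m, hm⟩ := eventually_atTop.1 hev
      exact ⟨m, fun n hn => not_lt.1 (hm n hn)⟩
    rcases hc.2.lt_or_eq with hlt | rfl
    · exact denseInter_of_generates fun i hi => by
        obtain ⟨m, hm⟩ := hgood i hi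
        exact hG i x hx (infinite_of_noiseRate_le hlt hm) ⟨m, hm⟩
    · exact denseInter_of_generates fun i _ =>
        hG i id Function.injective_id (hinf i) ⟨0, fun n _ => noiseRate_le_one _ _ n⟩
  · intro h
    refine ⟨intersectionGenerator 𝓛 c ρ, fun i x hx _ hnoise => ?_⟩
    have hev := eventually_intersectionGenerator (ρ := ρ) hinf (fun s hs hgood => by
      refine (h s hs x hx).resolve_left ?_
      rintro ⟨j, hj, hbad⟩
      obtain ⟨m, hm⟩ := hgood j hj
      obtain ⟨n, hn, hmn⟩ := hbad.exists_gt m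
      exact not_lt.2 (hm n hmn.le) hn) hnoise
    refine ⟨eventually_atTop.1 (hev.mono fun _ hn => hn.1), ?_⟩
    exact le_liminf_of_le (isBoundedUnder_of ⟨1, fun n => lowDensity_le_one _ _⟩ :
      IsBoundedUnder (· ≤ ·) atTop _).isCoboundedUnder_ge (hev.mono fun _ hn => hn.2)
end

section
/- For every integer k ≥ 2 and every real M ≥ 1, there exist infinite languages L_1, …, L_k ⊆ ℕ with ⋂_{i=1}^k L_i = ∅ and a single injective sequence x : ℕ → ℕ such that for each i ∈ {1,…,k}: L_i ⊆ range(x), the set {n : x_n ∈ L_i} is infinite, x is an M-bounded displacement enumeration with respect to L_i, and limsup_{n→∞} R(L_i; x_{1:n}) ≤ 1/k. Consequently, for every function G : List ℕ → ℕ there exists some i ∈ {1,…,k} for which it is NOT the case that eventually G(x_1,…,x_n) ∈ L_i \ {x_1,…,x_n}; i.e., generation in the limit from the collection {L_1,…,L_k} under noise rate 1/k is impossible even restricted to M-bounded enumerations. -/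
open Filter Set Topology

open Classical in
/-- The 1-indexed position `σ(y, L)` of `y` in the increasing enumeration of `L`
(and `0` if `y ∉ L`). -/
noncomputable def position (y : ℕ) (L : Set ℕ) : ℕ :=
  if y ∈ L then {z | z ∈ L ∧ z ≤ y}.ncard else 0

/-- `x` is an `M`-bounded displacement enumeration w.r.t. `L`:
`σ(x_n, L) ≤ M · n` for all sufficiently large `n` (here `x t` is the `(t+1)`-st element). -/
def MBounded (x : ℕ → ℕ) (L : Set ℕ) (M : ℝ) : Prop :=
  ∃ nstar : ℕ, ∀ n ≥ nstar, (position (x n) L : ℝ) ≤ M * (n + 1)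

/-- At most `n / k + 1` of the numbers below `n` lie in a given residue class modulo `k`. -/
theorem ncard_lt_and_mod_eq_le (k i n : ℕ) : {t | t < n ∧ t % k = i}.ncard ≤ n / k + 1 := by
  rw [← Finset.card_range (n / k + 1), ← Set.ncard_coe_finset]
  refine Set.ncard_le_ncard_of_injOn (fun t => t / k) ?_ ?_ (Finset.finite_toSet _)
  · rintro t ⟨ht, -⟩
    simpa using Nat.lt_succ_of_le (Nat.div_le_div_right ht.le)
  · rintro s ⟨-, hs⟩ t ⟨-, ht⟩ (hst : s / k = t / k)
    rw [← Nat.div_add_mod s k, ← Nat.div_add_mod t k, hst, hs, ht]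

/-- Along the identity stream, the complement of a residue class modulo `k` has asymptotic noise
rate at most `1 / k`. -/
theorem limsup_noiseRate_mod_ne_le (k i : ℕ) :
    limsup (noiseRate {n | n % k ≠ i} id) atTop ≤ 1 / (k : ℝ) := by
  have hlim : Tendsto (fun n : ℕ => 1 / (k : ℝ) + 1 / (n : ℝ)) atTop (𝓝 (1 / (k : ℝ))) := by
    simpa using tendsto_const_nhds.add (tendsto_one_div_atTop_nhds_zero_nat (𝕜 := ℝ))
  rw [← hlim.limsup_eq]
  refine limsup_le_limsup ?_ ?_ hlim.isBoundedUnder_le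
  · filter_upwards [eventually_gt_atTop 0] with n hn
    have hn' : (0 : ℝ) < n := Nat.cast_pos.2 hn
    have hcard : (({t | t < n ∧ t % k = i}.ncard : ℕ) : ℝ) ≤ n / k + 1 :=
      (Nat.cast_le.2 (ncard_lt_and_mod_eq_le k i n)).trans (by
        push_cast
        gcongr
        exact Nat.cast_div_le)
    have hset : {t | t < n ∧ id t ∉ {n | n % k ≠ i}} = {t | t < n ∧ t % k = i} := by
      ext t
      simp
    rw [noiseRate, hset, div_le_iff₀ hn', add_mul, one_div_mul_cancel hn'.ne', one_div_mul_eq_div]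
    exact hcard
  · exact isCoboundedUnder_le_of_le atTop (x := 0) fun n => by
      unfold noiseRate
      positivity

/-- A residue class modulo `k ≥ 2` misses infinitely many natural numbers. -/
theorem infinite_mod_ne {k : ℕ} (hk : 2 ≤ k) (i : ℕ) : {n : ℕ | n % k ≠ i}.Infinite := by
  refine Set.infinite_of_forall_exists_gt fun a => ?_
  by_cases h : (a + 1) % k = i
  · refine ⟨a + 2, fun h' => ?_, by omega⟩
    have hmod : a + 1 + 0 ≡ a + 1 + 1 [MOD k] := h.trans h'.symm
    have := (Nat.ModEq.add_left_cancel' _ hmod).symm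
    rw [Nat.ModEq, Nat.mod_eq_of_lt (by omega : 1 < k), Nat.zero_mod] at this
    omega
  · exact ⟨a + 1, h, by omega⟩

theorem position_le_succ (y : ℕ) (L : Set ℕ) : position y L ≤ y + 1 := by
  unfold position
  split_ifs
  · rw [← Finset.card_range (y + 1), ← Set.ncard_coe_finset]
    exact Set.ncard_le_ncard (fun z hz => by simpa using Nat.lt_succ_of_le hz.2)
      (Finset.finite_toSet _)
  · exact Nat.zero_le _

/-- No generator succeeds on a single stream for every member of a finite family of languages
with empty intersection. -/
theorem exists_not_generates {ι : Type*} [Finite ι] {L : ι → Set ℕ} (hL : ⋂ i, L i = ∅)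
    (x : ℕ → ℕ) (G : List ℕ → ℕ) :
    ∃ i, ¬ ∃ N : ℕ, ∀ n ≥ N, G (prefixList x n) ∈ L i \ seen x n := by
  by_contra! h
  obtain ⟨n, hn⟩ := (eventually_all.2 fun i => eventually_atTop.2 (h i)).exists
  have : G (prefixList x n) ∈ ⋂ i, L i := Set.mem_iInter.2 fun i => (hn i).1
  rwa [hL] at this

/-- Generation under constant noise rate `1/k` remains impossible even when restricted to
`M`-bounded displacement enumerations. -/
theorem generation_constant_noise_hard_bounded (k : ℕ) (hk : 2 ≤ k) (M : ℝ) (hM : 1 ≤ M) :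
    ∃ L : Fin k → Set ℕ,
      (∀ i, (L i).Infinite) ∧ (⋂ i, L i) = ∅ ∧
      ∃ x : ℕ → ℕ, Function.Injective x ∧
        (∀ i, L i ⊆ Set.range x ∧ {n : ℕ | x n ∈ L i}.Infinite ∧ MBounded x (L i) M ∧
          Filter.limsup (noiseRate (L i) x) Filter.atTop ≤ 1 / (k : ℝ)) ∧
        ∀ G : List ℕ → ℕ, ∃ i, ¬ ∃ N : ℕ, ∀ n ≥ N, G (prefixList x n) ∈ L i \ seen x n := by
  have hinter : ⋂ i : Fin k, {n : ℕ | n % k ≠ i} = ∅ :=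
    Set.eq_empty_of_forall_notMem fun n hn =>
      Set.mem_iInter.1 hn ⟨n % k, Nat.mod_lt n (by omega)⟩ rfl
  refine ⟨fun i => {n | n % k ≠ i}, fun i => infinite_mod_ne hk i, hinter, id,
    Function.injective_id, fun i => ⟨by simp, infinite_mod_ne hk i, ⟨0, fun n _ => ?_⟩,
      limsup_noiseRate_mod_ne_le k i⟩, exists_not_generates hinter id⟩
  calc (position (id n) _ : ℝ) ≤ ((n + 1 : ℕ) : ℝ) := Nat.cast_le.2 (position_le_succ n _)
    _ = 1 * ((n : ℝ) + 1) := by push_cast; ring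
    _ ≤ M * (n + 1) := by gcongr
end
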